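/- Let Φ : M_n(ℂ) → M_m(ℂ) be a trace-preserving linear map whose Hilbert–Schmidt adjoint Φ* is a Schwarz contraction, i.e., Φ*(Y)ᴴ Φ*(Y) ≤ Φ*(Yᴴ Y) in the Loewner order for all Y ∈ M_m(ℂ) (this forces Φ to be positive). Let f : (0,∞) → ℝ be operator convex and let ρ, σ ∈ M_n(ℂ) be positive definite. Then S_f(Φ(ρ)‖Φ(σ)) ≤ S_f(ρ‖σ), where (since Φ(ρ) and Φ(σ) have equal supports) S_f(Φ(ρ)‖Φ(σ)) := Σ_{a,b > 0} b·f(a/b)·Tr(P'_a Q'_b), the sum running over the nonzero eigenvalues a of Φ(ρ) and b of Φ(σ) with spectral projections P'_a, Q'_b. -/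

import Mathlib

open Matrix
open scoped ComplexOrder

/-- `f : (0,∞) → ℝ` is operator convex: for every size `m`, positive definite
`A B : M_m(ℂ)` and `t ∈ [0,1]`, `f(tA + (1-t)B) ≤ t f(A) + (1-t) f(B)` in the
Loewner order (`f` applied by the spectral functional calculus). -/
def OperatorConvexOn (f : ℝ → ℝ) : Prop :=
  ∀ (m : ℕ) (A B : Matrix (Fin m) (Fin m) ℂ), A.PosDef → B.PosDef →
    ∀ t : ℝ, 0 ≤ t → t ≤ 1 →
      (t • cfc f A + (1 - t) • cfc f B - cfc f (t • A + (1 - t) • B)).PosSemidef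

/-- Spectral projection of a Hermitian matrix `A` onto the eigenvalue `a`. -/
noncomputable def specProj {n : ℕ} (A : Matrix (Fin n) (Fin n) ℂ) (a : ℝ) :
    Matrix (Fin n) (Fin n) ℂ :=
  cfc (fun x : ℝ => if x = a then (1 : ℝ) else 0) A

/-- The adjoint of a linear map between matrix spaces with respect to the
Hilbert–Schmidt inner product `⟨A, B⟩ = Tr(Aᴴ B)`. -/
noncomputable def adjointMap {n m : ℕ}
    (Φ : Matrix (Fin n) (Fin n) ℂ →ₗ[ℂ] Matrix (Fin m) (Fin m) ℂ) :
    Matrix (Fin m) (Fin m) ℂ → Matrix (Fin n) (Fin n) ℂ :=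
  fun Y => Matrix.of fun i j => Matrix.trace ((Φ (Matrix.single i j 1))ᴴ * Y)

section FunctionalCalculus

variable {ι κ : Type*} [Fintype ι] [DecidableEq ι] [Fintype κ] [DecidableEq κ]

lemma exists_polynomial_cfc_eq (f : ℝ → ℝ) {A : Matrix ι ι ℂ} {B : Matrix κ κ ℂ}
    (hA : A.IsHermitian) (hB : B.IsHermitian) :
    ∃ p : Polynomial ℝ, cfc f A = Polynomial.aeval A p ∧ cfc f B = Polynomial.aeval B p := by
  classical
  have hfA : (spectrum ℝ A).Finite := A.finite_real_spectrum
  have hfB : (spectrum ℝ B).Finite := B.finite_real_spectrum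
  set s := (hfA.union hfB).toFinset with hs
  have key : ∀ x ∈ s, f x = (Lagrange.interpolate s id f).eval x := fun x hx =>
    (Lagrange.eval_interpolate_at_node (v := id) f Function.injective_id.injOn hx).symm
  refine ⟨Lagrange.interpolate s id f, ?_, ?_⟩
  · rw [← cfc_polynomial _ A hA]
    exact cfc_congr fun x hx => key x (by simp [hs, hx])
  · rw [← cfc_polynomial _ B hB]
    exact cfc_congr fun x hx => key x (by simp [hs, hx])

lemma aeval_mul_eq_mul_aeval {A : Matrix ι ι ℂ} {B : Matrix κ κ ℂ} {W : Matrix ι κ ℂ}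
    (h : A * W = W * B) (p : Polynomial ℝ) :
    Polynomial.aeval A p * W = W * Polynomial.aeval B p := by
  induction p using Polynomial.induction_on' with
  | add p q hp hq => simp [Matrix.add_mul, Matrix.mul_add, hp, hq]
  | monomial k c =>
    have hk : A ^ k * W = W * B ^ k := by
      induction k with
      | zero => simp
      | succ k ih => rw [pow_succ, pow_succ, Matrix.mul_assoc, h, ← Matrix.mul_assoc, ih,
          Matrix.mul_assoc]
    simp [Polynomial.aeval_monomial, Algebra.algebraMap_eq_smul_one, hk]

lemma cfc_mul_eq_mul_cfc (f : ℝ → ℝ) {A : Matrix ι ι ℂ} {B : Matrix κ κ ℂ} {W : Matrix ι κ ℂ}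
    (hA : A.IsHermitian) (hB : B.IsHermitian) (h : A * W = W * B) :
    cfc f A * W = W * cfc f B := by
  obtain ⟨p, hpA, hpB⟩ := exists_polynomial_cfc_eq f hA hB
  rw [hpA, hpB, aeval_mul_eq_mul_aeval h]

lemma cfc_diagonal (f : ℝ → ℝ) (d : ι → ℝ) :
    cfc f (diagonal fun i => (d i : ℂ)) = diagonal fun i => (f (d i) : ℂ) := by
  have hd : (diagonal fun i => (d i : ℂ)).IsHermitian :=
    isHermitian_diagonal_of_self_adjoint _ (by ext i; simp)
  ext i j
  have h1 : (diagonal fun i => (d i : ℂ)) *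
        (Matrix.of fun i (_ : Unit) => if i = j then (1 : ℂ) else 0)
      = (Matrix.of fun i (_ : Unit) => if i = j then (1 : ℂ) else 0) *
        (algebraMap ℝ (Matrix Unit Unit ℂ) (d j)) := by
    ext k u
    by_cases hk : k = j <;> simp [Matrix.mul_apply, Matrix.algebraMap_matrix_apply, hk]
  have hc : (algebraMap ℝ (Matrix Unit Unit ℂ) (d j)).IsHermitian :=
    IsSelfAdjoint.algebraMap _ (IsSelfAdjoint.all _)
  have h2 := cfc_mul_eq_mul_cfc f hd hc h1
  have h3 := congrFun (congrFun h2 i) ()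
  rw [cfc_algebraMap] at h3
  by_cases hk : i = j <;>
    simpa [diagonal_apply, Matrix.mul_apply, Matrix.algebraMap_matrix_apply, hk] using h3

lemma cfc_fromBlocks (f : ℝ → ℝ) {A : Matrix ι ι ℂ} {B : Matrix κ κ ℂ}
    (hA : A.IsHermitian) (hB : B.IsHermitian) :
    cfc f (fromBlocks A 0 0 B) = fromBlocks (cfc f A) 0 0 (cfc f B) := by
  have hM : (fromBlocks A 0 0 B).IsHermitian := hA.fromBlocks (by simp) hB
  have h1 := cfc_mul_eq_mul_cfc f hM hA (W := fromRows 1 0)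
    (by simp [fromBlocks_mul_fromRows, fromRows_mul])
  have h2 := cfc_mul_eq_mul_cfc f hM hB (W := fromRows 0 1)
    (by simp [fromBlocks_mul_fromRows, fromRows_mul])
  rw [← fromBlocks_toBlocks (cfc f (fromBlocks A 0 0 B))] at h1 h2 ⊢
  simp only [fromBlocks_mul_fromRows, fromRows_mul, Matrix.mul_one, Matrix.mul_zero,
    Matrix.one_mul, Matrix.zero_mul, add_zero, zero_add] at h1 h2
  obtain ⟨h11, h12⟩ := fromRows_inj h1
  obtain ⟨h21, h22⟩ := fromRows_inj h2
  rw [h11, h12, h21, h22]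

lemma cfc_submatrix_equiv (f : ℝ → ℝ) {A : Matrix ι ι ℂ} (hA : A.IsHermitian) (e : κ ≃ ι) :
    cfc f (A.submatrix e e) = (cfc f A).submatrix e e := by
  have h := cfc_mul_eq_mul_cfc f (hA.submatrix e) hA
    (W := (1 : Matrix ι ι ℂ).submatrix e id) (by
      rw [Matrix.submatrix_mul_equiv, Matrix.mul_one]
      ext i j
      simp [Matrix.mul_apply, Matrix.one_apply])
  ext i j
  have := congrFun (congrFun h i) (e j)
  simpa [Matrix.mul_apply, Matrix.one_apply] using this

end FunctionalCalculus

namespace OperatorConvexOn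

variable {ι κ : Type*} [Fintype ι] [DecidableEq ι] [Fintype κ] [DecidableEq κ] {f : ℝ → ℝ}

lemma posSemidef_midpoint (hf : OperatorConvexOn f) {A B : Matrix ι ι ℂ}
    (hA : A.PosDef) (hB : B.PosDef) :
    ((2⁻¹ : ℝ) • cfc f A + (2⁻¹ : ℝ) • cfc f B
      - cfc f ((2⁻¹ : ℝ) • A + (2⁻¹ : ℝ) • B)).PosSemidef := by
  let e := (Fintype.equivFin ι).symm
  have hC : ((2⁻¹ : ℝ) • A + (2⁻¹ : ℝ) • B).IsHermitian := by
    have := hA.isHermitian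
    have := hB.isHermitian
    simp_all [Matrix.IsHermitian]
  have h := hf _ (A.submatrix e e) (B.submatrix e e) (hA.submatrix e.injective)
    (hB.submatrix e.injective) 2⁻¹ (by norm_num) (by norm_num)
  have hsub : ∀ X Y : Matrix ι ι ℂ, (2⁻¹ : ℝ) • X.submatrix e e + (2⁻¹ : ℝ) • Y.submatrix e e
      = ((2⁻¹ : ℝ) • X + (2⁻¹ : ℝ) • Y).submatrix e e := fun _ _ => rfl
  rw [show (1 - 2⁻¹ : ℝ) = 2⁻¹ by norm_num, cfc_submatrix_equiv f hA.isHermitian,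
    cfc_submatrix_equiv f hB.isHermitian, hsub, hsub, cfc_submatrix_equiv f hC] at h
  exact (Matrix.posSemidef_submatrix_equiv e).1 h

/-- Jensen's operator inequality for compressions by an isometry. -/
lemma posSemidef_compression (hf : OperatorConvexOn f) {B : Matrix κ κ ℂ} (hB : B.PosDef)
    {W : Matrix κ ι ℂ} (hW : Wᴴ * W = 1) :
    (Wᴴ * cfc f B * W - cfc f (Wᴴ * B * W)).PosSemidef := by
  set U : Matrix κ κ ℂ := (2 : ℝ) • (W * Wᴴ) - 1 with hU
  have hUH : Uᴴ = U := by simp [hU]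
  have hUW : U * W = W := by
    rw [hU, Matrix.sub_mul, Matrix.smul_mul, Matrix.mul_assoc, hW, two_smul]; simp
  have hWU : Wᴴ * U = Wᴴ := by rw [← hUH, ← conjTranspose_mul, hUW]
  have hUU : U * U = 1 := by
    rw [hU, Matrix.mul_sub, Matrix.mul_smul, ← Matrix.mul_assoc, ← hU, hUW, hU]; simp
  have hUunit : IsUnit U := IsUnit.of_mul_eq_one U hUU
  have hB' : (U * B * U).PosDef := by
    have := (Matrix.IsUnit.posDef_star_right_conjugate_iff hUunit).2 hB
    rwa [star_eq_conjTranspose, hUH] at this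
  have hWBW : (Wᴴ * B * W).IsHermitian := isHermitian_conjTranspose_mul_mul _ hB.isHermitian
  have h := (hf.posSemidef_midpoint hB hB').conjTranspose_mul_mul_same W
  have h1 : cfc f (U * B * U) * W = U * cfc f B * W := by
    rw [← cfc_mul_eq_mul_cfc f hB'.isHermitian hB.isHermitian (W := U)
      (by rw [Matrix.mul_assoc, hUU, Matrix.mul_one]), Matrix.mul_assoc _ U W, hUW]
  have hC : ((2⁻¹ : ℝ) • B + (2⁻¹ : ℝ) • (U * B * U)).IsHermitian := by
    have := hB.isHermitian
    have := hB'.isHermitian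
    simp_all [Matrix.IsHermitian]
  have h2 := cfc_mul_eq_mul_cfc f hC hWBW (W := W) (by
    rw [Matrix.add_mul, Matrix.smul_mul, Matrix.smul_mul, Matrix.mul_assoc _ U W, hUW,
      Matrix.mul_assoc U B W, hU, Matrix.sub_mul, Matrix.smul_mul]
    simp only [smul_sub, smul_smul, Matrix.one_mul, Matrix.mul_assoc]
    norm_num)
  clear_value U
  convert h using 1
  rw [Matrix.mul_assoc Wᴴ (_ - _) W, Matrix.sub_mul, h2, Matrix.add_mul,
    Matrix.smul_mul, Matrix.smul_mul, h1, Matrix.mul_sub, ← Matrix.mul_assoc Wᴴ W, hW,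
    Matrix.one_mul, Matrix.mul_add, Matrix.mul_smul, Matrix.mul_smul, Matrix.mul_assoc U,
    ← Matrix.mul_assoc Wᴴ U, hWU, ← add_smul, ← Matrix.mul_assoc Wᴴ (cfc f B)]
  norm_num

end OperatorConvexOn

lemma Matrix.PosSemidef.exists_conjTranspose_mul_self {ι : Type*} [Fintype ι] [DecidableEq ι]
    {A : Matrix ι ι ℂ} (hA : A.PosSemidef) : ∃ E : Matrix ι ι ℂ, Eᴴ * E = A := by
  open scoped MatrixOrder in
  have h0 : 0 ≤ A := Matrix.nonneg_iff_posSemidef.2 hA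
  have hs : (CFC.sqrt A).IsHermitian :=
    (Matrix.nonneg_iff_posSemidef.1 (CFC.sqrt_nonneg A)).isHermitian
  exact ⟨CFC.sqrt A, by rw [hs.eq, CFC.sqrt_mul_sqrt_self A h0]⟩

lemma Matrix.PosDef.exists_isUnit_conjTranspose_mul_self {ι : Type*} [Fintype ι] [DecidableEq ι]
    {A : Matrix ι ι ℂ} (hA : A.PosDef) : ∃ E : Matrix ι ι ℂ, IsUnit E ∧ Eᴴ * E = A := by
  obtain ⟨E, hE⟩ := hA.posSemidef.exists_conjTranspose_mul_self
  exact ⟨E, (Matrix.isUnit_iff_isUnit_det E).2 (isUnit_of_mul_isUnit_right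
    (x := Eᴴ.det) (by rw [← det_mul, hE]; exact (Matrix.isUnit_iff_isUnit_det A).1 hA.isUnit)), hE⟩

/-- The orthogonal projection onto the line spanned by `ξ`. -/
noncomputable def rankOneProj {ι : Type*} [Fintype ι] (ξ : ι → ℂ) : Matrix ι ι ℂ :=
  (star ξ ⬝ᵥ ξ)⁻¹ • vecMulVec ξ (star ξ)

section RankOneProj

variable {ι κ : Type*} [Fintype ι] (ξ : ι → ℂ)

lemma rankOneProj_posSemidef : (rankOneProj ξ).PosSemidef :=
  (posSemidef_vecMulVec_self_star ξ).smul (inv_nonneg.2 (dotProduct_star_self_nonneg ξ))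

lemma rankOneProj_mulVec : rankOneProj ξ *ᵥ ξ = ξ := by
  by_cases h : star ξ ⬝ᵥ ξ = 0
  · simp [dotProduct_star_self_eq_zero.1 h]
  · rw [rankOneProj, smul_mulVec, vecMulVec_mulVec]
    ext i
    simp only [Pi.smul_apply, MulOpposite.smul_eq_mul_unop, MulOpposite.unop_op, smul_eq_mul]
    field_simp

lemma mul_rankOneProj_of_mulVec_eq_zero {A : Matrix κ ι ℂ} (h : A *ᵥ ξ = 0) :
    A * rankOneProj ξ = 0 := by
  rw [rankOneProj, Matrix.mul_smul, mul_vecMulVec, h, zero_vecMulVec, smul_zero]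

lemma rankOneProj_mul_self : rankOneProj ξ * rankOneProj ξ = rankOneProj ξ := by
  conv_lhs => rw [rankOneProj, Matrix.smul_mul, Matrix.mul_smul]
  rw [vecMulVec_mul_vecMulVec, vecMulVec_smul]
  by_cases h : star ξ ⬝ᵥ ξ = 0
  · simp [rankOneProj, h]
  · rw [rankOneProj, smul_smul, smul_smul, mul_assoc, inv_mul_cancel₀ h, mul_one]

end RankOneProj

section Contraction

variable {ι κ : Type*} [Fintype ι] [DecidableEq ι] [Fintype κ] [DecidableEq κ] {f : ℝ → ℝ}

omit [DecidableEq ι] [DecidableEq κ] in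
lemma star_dotProduct_fromBlocks_diagonal_mulVec (A : Matrix κ κ ℂ) (B : Matrix ι ι ℂ)
    (x : κ ⊕ ι → ℂ) :
    star x ⬝ᵥ (fromBlocks A 0 0 B *ᵥ x)
      = star (x ∘ Sum.inl) ⬝ᵥ (A *ᵥ (x ∘ Sum.inl))
        + star (x ∘ Sum.inr) ⬝ᵥ (B *ᵥ (x ∘ Sum.inr)) := by
  rw [fromBlocks_mulVec, dotProduct, Fintype.sum_sum_type]
  simp only [Matrix.zero_mulVec, add_zero, zero_add, Sum.elim_inl, Sum.elim_inr]
  rfl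

omit [DecidableEq ι] [DecidableEq κ] in
lemma Matrix.PosDef.fromBlocks_diagonal {A : Matrix κ κ ℂ} {B : Matrix ι ι ℂ} (hA : A.PosDef)
    (hB : B.PosDef) : (fromBlocks A 0 0 B).PosDef := by
  refine Matrix.PosDef.of_dotProduct_mulVec_pos
    (hA.isHermitian.fromBlocks (by simp) hB.isHermitian) fun x hx => ?_
  rw [star_dotProduct_fromBlocks_diagonal_mulVec]
  by_cases hl : x ∘ Sum.inl = 0
  · have hr : x ∘ Sum.inr ≠ 0 := fun hr => hx (by
      ext (i | i)
      · exact congrFun hl i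
      · exact congrFun hr i)
    exact add_pos_of_nonneg_of_pos (hA.posSemidef.dotProduct_mulVec_nonneg (x ∘ Sum.inl))
      (hB.dotProduct_mulVec_pos hr)
  · exact add_pos_of_pos_of_nonneg (hA.dotProduct_mulVec_pos hl)
      (hB.posSemidef.dotProduct_mulVec_nonneg (x ∘ Sum.inr))

lemma OperatorConvexOn.dotProduct_cfc_le_of_posDef (hf : OperatorConvexOn f)
    {Δ : Matrix κ κ ℂ} (hΔ : Δ.PosDef) {Γ : Matrix ι ι ℂ} {V : Matrix κ ι ℂ} {ξ : ι → ℂ}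
    (hV : (1 - Vᴴ * V + rankOneProj ξ).PosDef) (hVξ : (1 - Vᴴ * V) *ᵥ ξ = 0)
    (hΓ : (Γ - Vᴴ * Δ * V + rankOneProj ξ).PosDef) (hΓξ : (Γ - Vᴴ * Δ * V) *ᵥ ξ = 0) :
    star ξ ⬝ᵥ (cfc f Γ *ᵥ ξ) ≤ star (V *ᵥ ξ) ⬝ᵥ (cfc f Δ *ᵥ (V *ᵥ ξ)) := by
  have hPP := rankOneProj_mul_self ξ
  have hPH : (rankOneProj ξ)ᴴ = rankOneProj ξ := (rankOneProj_posSemidef ξ).isHermitian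
  have hPξ := rankOneProj_mulVec ξ
  have hVP := mul_rankOneProj_of_mulVec_eq_zero ξ hVξ
  have hΓP := mul_rankOneProj_of_mulVec_eq_zero ξ hΓξ
  set P := rankOneProj ξ
  obtain ⟨E, hE, hES⟩ := hV.exists_isUnit_conjTranspose_mul_self
  have hEdet := (Matrix.isUnit_iff_isUnit_det E).1 hE
  set S := 1 - Vᴴ * V with hS
  set R := Γ - Vᴴ * Δ * V with hR
  clear_value P
  have hQH : (1 - P)ᴴ = 1 - P := by simp [hPH]
  have key : ∀ X : Matrix ι ι ℂ, X * P = 0 → Xᴴ = X → (1 - P) * (X + P) * (1 - P) = X := by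
    intro X hX hXH
    have hX' : P * X = 0 := by rw [← hPH, ← hXH, ← conjTranspose_mul, hX, conjTranspose_zero]
    have h1 : (X + P) * (1 - P) = X := by
      rw [Matrix.mul_sub, Matrix.add_mul _ _ P, hX, hPP]; simp
    rw [Matrix.mul_assoc, h1, Matrix.sub_mul, hX']; simp
  have hSH : Sᴴ = S := by simp [hS]
  have hRH : Rᴴ = R := by
    have := hΓ.isHermitian.eq
    rw [conjTranspose_add, hPH] at this
    exact add_right_cancel this
  set D : Matrix ι ι ℂ := (E⁻¹)ᴴ * (R + P) * E⁻¹ with hD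
  have hDpos : D.PosDef :=
    (Matrix.IsUnit.posDef_star_left_conjugate_iff
      ((Matrix.isUnit_nonsing_inv_iff).2 hE)).2 hΓ
  have hEinv : E⁻¹ * E = 1 := Matrix.nonsing_inv_mul E hEdet
  have hEDE : Eᴴ * D * E = R + P := by
    have h1 : Eᴴ * (E⁻¹)ᴴ = 1 := by rw [← conjTranspose_mul, hEinv, conjTranspose_one]
    calc Eᴴ * D * E = (Eᴴ * (E⁻¹)ᴴ) * (R + P) * (E⁻¹ * E) := by
          simp only [hD, Matrix.mul_assoc]
      _ = R + P := by rw [h1, hEinv, Matrix.one_mul, Matrix.mul_one]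
  have hF : (E * (1 - P)) *ᵥ ξ = 0 := by
    rw [← mulVec_mulVec, Matrix.sub_mulVec, hPξ]; simp
  have hFF : (E * (1 - P))ᴴ * (E * (1 - P)) = S := by
    rw [conjTranspose_mul, hQH, Matrix.mul_assoc, ← Matrix.mul_assoc Eᴴ, hES, ← Matrix.mul_assoc,
      key S hVP hSH]
  have hFDF : (E * (1 - P))ᴴ * D * (E * (1 - P)) = R := by
    rw [conjTranspose_mul, hQH]
    calc (1 - P) * Eᴴ * D * (E * (1 - P)) = (1 - P) * (Eᴴ * D * E) * (1 - P) := by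
          simp only [Matrix.mul_assoc]
      _ = R := by rw [hEDE, key R hΓP hRH]
  set F := E * (1 - P)
  clear_value F D
  have hM := hΔ.fromBlocks_diagonal hDpos
  have hW : (fromRows V F)ᴴ * fromRows V F = 1 := by
    rw [conjTranspose_fromRows_eq_fromCols_conjTranspose, fromCols_mul_fromRows, hFF, hS]
    simp
  have h := (hf.posSemidef_compression hM hW).dotProduct_mulVec_nonneg ξ
  rw [cfc_fromBlocks f hΔ.isHermitian hDpos.isHermitian,
    conjTranspose_fromRows_eq_fromCols_conjTranspose, fromCols_mul_fromBlocks,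
    fromCols_mul_fromBlocks, fromCols_mul_fromRows, fromCols_mul_fromRows] at h
  simp only [Matrix.mul_zero, add_zero, zero_add] at h
  rw [hFDF, hR, add_sub_cancel, Matrix.sub_mulVec, dotProduct_sub, Matrix.add_mulVec,
    ← mulVec_mulVec ξ _ F, hF, mulVec_zero, add_zero, sub_nonneg] at h
  refine h.trans_eq ?_
  rw [star_mulVec, ← dotProduct_mulVec, mulVec_mulVec, mulVec_mulVec, Matrix.mul_assoc]

omit [Fintype ι] in
lemma Matrix.PosSemidef.add_smul_one_add_smul_posDef {A P : Matrix ι ι ℂ} (hA : A.PosSemidef)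
    (hP : P.PosSemidef) {a b c : ℝ} (ha : 0 ≤ a) (hb : 0 < b) (hc : 0 ≤ c) :
    ((a : ℂ) • A + ((b : ℂ) • (1 : Matrix ι ι ℂ) + (c : ℂ) • P)).PosDef :=
  Matrix.PosDef.posSemidef_add (hA.smul (by exact_mod_cast ha))
    ((Matrix.PosDef.one.smul (by exact_mod_cast hb)).add_posSemidef
      (hP.smul (by exact_mod_cast hc)))

end Contraction

section DiagonalContraction

variable {ι κ : Type*} [Fintype ι] [DecidableEq ι] [Fintype κ] [DecidableEq κ] {f : ℝ → ℝ}

lemma star_dotProduct_diagonal_mulVec (d : ι → ℝ) (x : ι → ℂ) :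
    star x ⬝ᵥ ((diagonal fun i => (d i : ℂ)) *ᵥ x)
      = ((∑ i, d i * Complex.normSq (x i) : ℝ) : ℂ) := by
  simp only [dotProduct, mulVec_diagonal, Pi.star_apply, RCLike.star_def, Complex.ofReal_sum,
    Complex.ofReal_mul, Complex.normSq_eq_conj_mul_self]
  exact Finset.sum_congr rfl fun i _ => by ring

lemma OperatorConvexOn.exists_bound_of_contraction (hf : OperatorConvexOn f)
    {d : κ → ℝ} (hd : ∀ i, 0 < d i) {e : ι → ℝ} (he : ∀ j, 0 < e j)
    {V : Matrix κ ι ℂ} {ξ : ι → ℂ}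
    (hV : (1 - Vᴴ * V).PosSemidef) (hVξ : (1 - Vᴴ * V) *ᵥ ξ = 0)
    (hR : ((diagonal fun j => (e j : ℂ)) - Vᴴ * (diagonal fun i => (d i : ℂ)) * V).PosSemidef)
    (hRξ : ((diagonal fun j => (e j : ℂ)) - Vᴴ * (diagonal fun i => (d i : ℂ)) * V) *ᵥ ξ = 0) :
    ∃ K : ℝ, ∀ ε : ℝ, 0 < ε → ε < 1 →
      ∑ j, f (e j) * Complex.normSq (ξ j)
        ≤ (1 - ε) * ∑ i, f (d i) * Complex.normSq ((V *ᵥ ξ) i) + ε * K := by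
  obtain ⟨c, ⟨hc1, hce⟩, hc0⟩ : ∃ c : ℝ, (c < 1 ∧ ∀ j, c < e j) ∧ 0 < c := by
    have h1 : ∀ᶠ c : ℝ in nhdsWithin 0 (Set.Ioi 0), c < 1 ∧ ∀ j, c < e j :=
      ((eventually_lt_nhds one_pos).and
        (Filter.eventually_all.2 fun j => eventually_lt_nhds (he j))).filter_mono
          nhdsWithin_le_nhds
    exact (h1.and self_mem_nhdsWithin).exists
  have hPsd := rankOneProj_posSemidef ξ
  have hPP := rankOneProj_mul_self ξ
  have hPH : (rankOneProj ξ)ᴴ = rankOneProj ξ := hPsd.isHermitian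
  have hPξ := rankOneProj_mulVec ξ
  have hmain := fun (Δ' : Matrix (κ ⊕ ι) (κ ⊕ ι) ℂ) hΔ' Γ (V' : Matrix (κ ⊕ ι) ι ℂ) =>
    hf.dotProduct_cfc_le_of_posDef (Δ := Δ') hΔ' (Γ := Γ) (V := V') (ξ := ξ)
  set P := rankOneProj ξ
  clear_value P
  set Δ : Matrix κ κ ℂ := diagonal fun i => (d i : ℂ) with hΔdef
  set Γ : Matrix ι ι ℂ := diagonal fun j => (e j : ℂ) with hΓdef
  have hΔ : Δ.PosDef := Matrix.PosDef.diagonal fun i => by exact_mod_cast hd i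
  set G : Matrix ι ι ℂ := (2⁻¹ : ℂ) • (1 + P) with hG
  set G' : Matrix ι ι ℂ := (2 : ℂ) • 1 - P with hG'
  have hGG' : G * G' = 1 := by
    rw [hG, hG', Matrix.smul_mul, Matrix.mul_sub, Matrix.add_mul, Matrix.add_mul, hPP]
    simp only [Matrix.mul_smul, Matrix.mul_one, Matrix.one_mul]
    module
  have hG'G : G' * G = 1 := mul_eq_one_comm.1 hGG'
  have hGH : Gᴴ = G := by simp [hG, hPH]
  have hG'H : G'ᴴ = G' := by simp [hG', hPH]
  have hGξ : G *ᵥ ξ = ξ := by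
    rw [hG, smul_mulVec, Matrix.add_mulVec, hPξ, Matrix.one_mulVec]; module
  have hGG : G * G = (4⁻¹ : ℂ) • (1 + (3 : ℂ) • P) := by
    rw [hG, Matrix.smul_mul, Matrix.mul_smul, Matrix.mul_add, Matrix.add_mul, Matrix.add_mul, hPP]
    simp only [Matrix.mul_one, Matrix.one_mul]
    module
  set X : Matrix ι ι ℂ := Γ - (c : ℂ) • 1 + (c : ℂ) • P with hX
  have hXpos : X.PosDef := by
    refine Matrix.PosDef.add_posSemidef ?_ (hPsd.smul (by exact_mod_cast hc0.le))
    have : Γ - (c : ℂ) • 1 = diagonal fun j => ((e j - c : ℝ) : ℂ) := by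
      rw [hΓdef, Matrix.smul_one_eq_diagonal, Matrix.diagonal_sub]
      push_cast
      rfl
    rw [this]
    exact Matrix.PosDef.diagonal fun j => by exact_mod_cast sub_pos.2 (hce j)
  set B : Matrix ι ι ℂ := G' * X * G' with hB
  have hBpos : B.PosDef := by
    have := (Matrix.IsUnit.posDef_star_left_conjugate_iff (IsUnit.of_mul_eq_one G hG'G)).2 hXpos
    rwa [star_eq_conjTranspose, hG'H] at this
  have hGBG : G * B * G = X := by
    calc G * B * G = (G * G') * X * (G' * G) := by simp only [hB, Matrix.mul_assoc]
      _ = X := by rw [hGG', hG'G, Matrix.one_mul, Matrix.mul_one]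
  clear_value B G X
  refine ⟨(star ξ ⬝ᵥ (cfc f B *ᵥ ξ)).re, fun ε hε0 hε1 => ?_⟩
  obtain ⟨s, hs⟩ : ∃ s : ℝ, s * s = 1 - ε :=
    ⟨√(1 - ε), Real.mul_self_sqrt (by linarith)⟩
  obtain ⟨t, ht⟩ : ∃ t : ℝ, t * t = ε := ⟨√ε, Real.mul_self_sqrt hε0.le⟩
  have hsC : (s : ℂ) * s = 1 - ε := by exact_mod_cast congrArg Complex.ofReal hs
  have htC : (t : ℂ) * t = ε := by exact_mod_cast congrArg Complex.ofReal ht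
  set V' : Matrix (κ ⊕ ι) ι ℂ := fromRows ((s : ℂ) • V) ((t : ℂ) • G) with hV'
  have hV'H : V'ᴴ = fromCols ((s : ℂ) • Vᴴ) ((t : ℂ) • G) := by
    rw [hV', conjTranspose_fromRows_eq_fromCols_conjTranspose]
    simp [hGH]
  have hM := Matrix.PosDef.fromBlocks_diagonal hΔ hBpos
  have e1 : 1 - V'ᴴ * V' = ((1 - ε : ℝ) : ℂ) • (1 - Vᴴ * V)
      + ((3 / 4 * ε : ℝ) : ℂ) • (1 - P) := by
    rw [hV'H, hV', fromCols_mul_fromRows]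
    simp only [Matrix.smul_mul, Matrix.mul_smul, smul_smul, hsC, htC]
    rw [hGG]
    push_cast
    module
  have e2 : Γ - V'ᴴ * fromBlocks Δ 0 0 B * V' = ((1 - ε : ℝ) : ℂ) • (Γ - Vᴴ * Δ * V)
      + ((c * ε : ℝ) : ℂ) • (1 - P) := by
    rw [hV'H, hV', fromCols_mul_fromBlocks, fromCols_mul_fromRows]
    simp only [Matrix.smul_mul, Matrix.mul_smul, Matrix.mul_zero, add_zero, zero_add, smul_smul,
      hsC, htC, hGBG, hX]
    push_cast
    module
  have hP0 : (1 - P) *ᵥ ξ = 0 := by rw [Matrix.sub_mulVec, hPξ, Matrix.one_mulVec, sub_self]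
  have hcε : c * ε < 1 := by nlinarith
  have h := hmain (fromBlocks Δ 0 0 B) hM Γ V' (by
      have := hV.add_smul_one_add_smul_posDef hPsd (a := 1 - ε) (b := 3 / 4 * ε)
        (c := 1 - 3 / 4 * ε) (by linarith) (by linarith) (by linarith)
      rw [e1]
      convert this using 1
      push_cast
      module) (by
      rw [e1, Matrix.add_mulVec, smul_mulVec, smul_mulVec, hVξ, hP0]; simp) (by
      have := hR.add_smul_one_add_smul_posDef hPsd (a := 1 - ε) (b := c * ε)
        (c := 1 - c * ε) (by linarith) (by positivity) (by linarith)
      rw [e2]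
      convert this using 1
      push_cast
      module) (by
      rw [e2, Matrix.add_mulVec, smul_mulVec, smul_mulVec, hRξ, hP0]; simp)
  rw [cfc_fromBlocks f hΔ.isHermitian hBpos.isHermitian, hV', fromRows_mulVec, smul_mulVec,
    smul_mulVec, hGξ, star_dotProduct_fromBlocks_diagonal_mulVec, Sum.elim_comp_inl,
    Sum.elim_comp_inr, hΓdef, hΔdef, cfc_diagonal, cfc_diagonal,
    star_dotProduct_diagonal_mulVec] at h
  simp only [mulVec_smul, star_smul, smul_dotProduct, dotProduct_smul, RCLike.star_def,
    Complex.conj_ofReal, smul_smul, hsC, htC, star_dotProduct_diagonal_mulVec] at h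
  simpa using (Complex.le_def.1 h).1

lemma OperatorConvexOn.sum_le_sum_of_contraction (hf : OperatorConvexOn f)
    {d : κ → ℝ} (hd : ∀ i, 0 < d i) {e : ι → ℝ} (he : ∀ j, 0 < e j)
    (V : (ι → ℂ) →ₗ[ℂ] (κ → ℂ)) {ξ : ι → ℂ}
    (hV : ∀ x, ∑ i, Complex.normSq (V x i) ≤ ∑ j, Complex.normSq (x j))
    (hVξ : ∑ i, Complex.normSq (V ξ i) = ∑ j, Complex.normSq (ξ j))
    (hR : ∀ x, ∑ i, d i * Complex.normSq (V x i) ≤ ∑ j, e j * Complex.normSq (x j))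
    (hRξ : ∑ i, d i * Complex.normSq (V ξ i) = ∑ j, e j * Complex.normSq (ξ j)) :
    ∑ j, f (e j) * Complex.normSq (ξ j) ≤ ∑ i, f (d i) * Complex.normSq (V ξ i) := by
  set M := LinearMap.toMatrix' V
  have hMV : ∀ x, M *ᵥ x = V x := fun x => LinearMap.toMatrix'_mulVec V x
  have quad : ∀ (d' : κ → ℝ) (e' : ι → ℝ) (x : ι → ℂ),
      star x ⬝ᵥ (((diagonal fun j => (e' j : ℂ)) - Mᴴ * (diagonal fun i => (d' i : ℂ)) * M) *ᵥ x)
        = ((∑ j, e' j * Complex.normSq (x j) - ∑ i, d' i * Complex.normSq (V x i) : ℝ) : ℂ) := by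
    intro d' e' x
    rw [Matrix.sub_mulVec, dotProduct_sub, star_dotProduct_diagonal_mulVec, ← mulVec_mulVec,
      ← mulVec_mulVec, dotProduct_mulVec, ← star_mulVec, hMV, star_dotProduct_diagonal_mulVec,
      Complex.ofReal_sub]
  have herm : ∀ (d' : κ → ℝ) (e' : ι → ℝ),
      ((diagonal fun j => (e' j : ℂ)) - Mᴴ * (diagonal fun i => (d' i : ℂ)) * M).IsHermitian := by
    intro d' e'
    refine IsHermitian.sub (isHermitian_diagonal_of_self_adjoint _ (by ext; simp))
      (isHermitian_conjTranspose_mul_mul _ (isHermitian_diagonal_of_self_adjoint _ (by ext; simp)))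
  have psd : ∀ (d' : κ → ℝ) (e' : ι → ℝ),
      (∀ x, ∑ i, d' i * Complex.normSq (V x i) ≤ ∑ j, e' j * Complex.normSq (x j)) →
      ∑ i, d' i * Complex.normSq (V ξ i) = ∑ j, e' j * Complex.normSq (ξ j) →
      ((diagonal fun j => (e' j : ℂ)) - Mᴴ * (diagonal fun i => (d' i : ℂ)) * M).PosSemidef ∧
      ((diagonal fun j => (e' j : ℂ)) - Mᴴ * (diagonal fun i => (d' i : ℂ)) * M) *ᵥ ξ = 0 := by
    intro d' e' h1 h2
    have h3 := Matrix.PosSemidef.of_dotProduct_mulVec_nonneg (herm d' e') fun x => by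
      rw [quad]; exact_mod_cast sub_nonneg.2 (h1 x)
    exact ⟨h3, (h3.dotProduct_mulVec_zero_iff ξ).1 (by rw [quad, h2]; simp)⟩
  have h1 := psd (fun _ => 1) (fun _ => 1) (by simpa using hV) (by simpa using hVξ)
  simp only [Complex.ofReal_one, diagonal_one, Matrix.mul_one] at h1
  have h2 := psd d e hR hRξ
  obtain ⟨K, hK⟩ := hf.exists_bound_of_contraction hd he h1.1 h1.2 h2.1 h2.2
  rw [hMV] at hK
  set L := ∑ j, f (e j) * Complex.normSq (ξ j)
  set N := ∑ i, f (d i) * Complex.normSq (V ξ i)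
  have hlim : Filter.Tendsto (fun ε : ℝ => (1 - ε) * N + ε * K) (nhdsWithin 0 (Set.Ioi 0))
      (nhds N) := by
    have : Continuous fun ε : ℝ => (1 - ε) * N + ε * K := by fun_prop
    simpa using this.continuousWithinAt (s := Set.Ioi 0) (x := 0) |>.tendsto
  refine ge_of_tendsto hlim ?_
  filter_upwards [Ioo_mem_nhdsGT (one_pos : (0 : ℝ) < 1)] with ε hε using hK ε hε.1 hε.2

end DiagonalContraction

lemma Matrix.PosSemidef.trace_mul_nonneg {ι : Type*} [Fintype ι] [DecidableEq ι]
    {A B : Matrix ι ι ℂ} (hA : A.PosSemidef) (hB : B.PosSemidef) : 0 ≤ (A * B).trace := by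
  obtain ⟨E, rfl⟩ := hB.exists_conjTranspose_mul_self
  rw [← Matrix.mul_assoc, Matrix.trace_mul_comm, ← Matrix.mul_assoc]
  exact (hA.mul_mul_conjTranspose_same E).trace_nonneg

lemma Matrix.PosDef.eq_zero_of_trace_mul_eq_zero {ι : Type*} [Fintype ι] [DecidableEq ι]
    {A B : Matrix ι ι ℂ} (hA : A.PosDef) (hB : B.PosSemidef) (h : (A * B).trace = 0) : B = 0 := by
  obtain ⟨F, hF, rfl⟩ := hA.exists_isUnit_conjTranspose_mul_self
  obtain ⟨E, rfl⟩ := hB.exists_conjTranspose_mul_self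
  have h1 : ((E * Fᴴ) * (E * Fᴴ)ᴴ).trace = 0 := by
    rw [← h, conjTranspose_mul, conjTranspose_conjTranspose, ← Matrix.mul_assoc (Fᴴ * F),
      Matrix.trace_mul_comm (Fᴴ * F * Eᴴ)]
    simp only [Matrix.mul_assoc]
  have h2 := trace_mul_conjTranspose_self_eq_zero_iff.1 h1
  have h3 : IsUnit Fᴴ := by rw [← star_eq_conjTranspose]; exact hF.star
  rw [h3.mul_left_eq_zero.1 h2, Matrix.mul_zero]

section AdjointMap

variable {n m : ℕ} (Φ : Matrix (Fin n) (Fin n) ℂ →ₗ[ℂ] Matrix (Fin m) (Fin m) ℂ)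

lemma adjointMap_add (Y Z : Matrix (Fin m) (Fin m) ℂ) :
    adjointMap Φ (Y + Z) = adjointMap Φ Y + adjointMap Φ Z := by
  ext i j
  simp [adjointMap, Matrix.mul_add]

lemma adjointMap_smul (c : ℂ) (Y : Matrix (Fin m) (Fin m) ℂ) :
    adjointMap Φ (c • Y) = c • adjointMap Φ Y := by
  ext i j
  simp [adjointMap]

lemma trace_conjTranspose_mul_adjointMap (X : Matrix (Fin n) (Fin n) ℂ)
    (Y : Matrix (Fin m) (Fin m) ℂ) :
    (Xᴴ * adjointMap Φ Y).trace = ((Φ X)ᴴ * Y).trace := by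
  have hX : Φ X = ∑ i, ∑ j, X i j • Φ (Matrix.single i j 1) := by
    conv_lhs => rw [Matrix.matrix_eq_sum_single X]
    simp only [map_sum, ← map_smul, Matrix.smul_single, smul_eq_mul, mul_one]
  rw [hX]
  simp only [conjTranspose_sum, conjTranspose_smul, Matrix.sum_mul, Matrix.smul_mul,
    Matrix.trace_sum, Matrix.trace_smul]
  rw [Finset.sum_comm]
  simp [Matrix.trace, Matrix.mul_apply, adjointMap]

variable {Φ} (hSchwarz : ∀ Y : Matrix (Fin m) (Fin m) ℂ,
      (adjointMap Φ (Yᴴ * Y) - (adjointMap Φ Y)ᴴ * adjointMap Φ Y).PosSemidef)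

include hSchwarz

lemma adjointMap_posSemidef {Y : Matrix (Fin m) (Fin m) ℂ} (hY : Y.PosSemidef) :
    (adjointMap Φ Y).PosSemidef := by
  obtain ⟨E, rfl⟩ := hY.exists_conjTranspose_mul_self
  have := (hSchwarz E).add (posSemidef_conjTranspose_mul_self (adjointMap Φ E))
  rwa [sub_add_cancel] at this

lemma adjointMap_conjTranspose (Y : Matrix (Fin m) (Fin m) ℂ) :
    adjointMap Φ Yᴴ = (adjointMap Φ Y)ᴴ := by
  have hpsd : ∀ Z : Matrix (Fin m) (Fin m) ℂ,
      (adjointMap Φ (Zᴴ * Z))ᴴ = adjointMap Φ (Zᴴ * Z) := fun Z =>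
    (adjointMap_posSemidef hSchwarz (posSemidef_conjTranspose_mul_self Z)).isHermitian
  have h1 : ∀ Z : Matrix (Fin m) (Fin m) ℂ,
      (adjointMap Φ Z)ᴴ + (adjointMap Φ Zᴴ)ᴴ = adjointMap Φ Z + adjointMap Φ Zᴴ := by
    intro Z
    have e : (1 + Z)ᴴ * (1 + Z) = (conjTranspose 1 * 1 + Zᴴ * Z) + (Z + Zᴴ) := by
      simp only [conjTranspose_add, conjTranspose_one, Matrix.add_mul, Matrix.mul_add,
        Matrix.one_mul, Matrix.mul_one]
      abel
    have h := hpsd (1 + Z)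
    rw [e, adjointMap_add, adjointMap_add, adjointMap_add, conjTranspose_add, conjTranspose_add,
      hpsd 1, hpsd Z, conjTranspose_add] at h
    exact add_left_cancel h
  have h2 := h1 Y
  have h3 := h1 (Complex.I • Y)
  rw [conjTranspose_smul, adjointMap_smul, adjointMap_smul, conjTranspose_smul,
    conjTranspose_smul] at h3
  simp only [RCLike.star_def, Complex.conj_I, map_neg, neg_neg] at h3
  ext i j
  have h4 := congrFun (congrFun h2 i) j
  have h5 := congrFun (congrFun h3 i) j
  simp only [Matrix.add_apply, Matrix.smul_apply, smul_eq_mul] at h4 h5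
  linear_combination (-1 / 2 : ℂ) * h4 - (Complex.I / 2) * h5 -
    (((adjointMap Φ Y)ᴴ i j - (adjointMap Φ Yᴴ)ᴴ i j + adjointMap Φ Y i j
      - adjointMap Φ Yᴴ i j) / 2) * Complex.I_mul_I

lemma trace_map_mul (X : Matrix (Fin n) (Fin n) ℂ) (Z : Matrix (Fin m) (Fin m) ℂ) :
    (Φ X * Z).trace = (X * adjointMap Φ Z).trace := by
  have h := congrArg star (trace_conjTranspose_mul_adjointMap Φ X Zᴴ)
  rw [← trace_conjTranspose, ← trace_conjTranspose, conjTranspose_mul, conjTranspose_mul,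
    adjointMap_conjTranspose hSchwarz] at h
  simp only [conjTranspose_conjTranspose] at h
  rw [Matrix.trace_mul_comm, ← h, Matrix.trace_mul_comm]

lemma map_conjTranspose (X : Matrix (Fin n) (Fin n) ℂ) : Φ Xᴴ = (Φ X)ᴴ := by
  refine Matrix.ext_iff_trace_mul_right.2 fun Z => ?_
  rw [trace_map_mul hSchwarz, trace_conjTranspose_mul_adjointMap]

lemma map_posSemidef {X : Matrix (Fin n) (Fin n) ℂ} (hX : X.PosSemidef) :
    (Φ X).PosSemidef := by
  refine Matrix.PosSemidef.of_dotProduct_mulVec_nonneg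
    (by rw [Matrix.IsHermitian, ← map_conjTranspose hSchwarz, hX.isHermitian.eq]) fun x => ?_
  have h := hX.trace_mul_nonneg (adjointMap_posSemidef hSchwarz (posSemidef_vecMulVec_self_star x))
  rwa [← trace_map_mul hSchwarz, mul_vecMulVec, trace_vecMulVec, dotProduct_comm] at h

lemma adjointMap_one (hΦtr : ∀ X, (Φ X).trace = X.trace) : adjointMap Φ 1 = 1 := by
  refine Matrix.ext_iff_trace_mul_left.2 fun X => ?_
  rw [← trace_map_mul hSchwarz, Matrix.mul_one, Matrix.mul_one, hΦtr]

lemma adjointMap_eq_zero_of_map_mul_eq_zero {X : Matrix (Fin n) (Fin n) ℂ} (hX : X.PosDef)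
    {Z : Matrix (Fin m) (Fin m) ℂ} (hZ : Z.PosSemidef) (h : Φ X * Z = 0) :
    adjointMap Φ Z = 0 :=
  hX.eq_zero_of_trace_mul_eq_zero (adjointMap_posSemidef hSchwarz hZ) (by
    rw [← trace_map_mul hSchwarz, h, Matrix.trace_zero])

lemma trace_mul_conjTranspose_mul_adjointMap_le {X : Matrix (Fin n) (Fin n) ℂ}
    (hX : X.PosSemidef) (Y : Matrix (Fin m) (Fin m) ℂ) :
    (X * ((adjointMap Φ Y)ᴴ * adjointMap Φ Y)).trace ≤ (Φ X * (Yᴴ * Y)).trace := by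
  have h := hX.trace_mul_nonneg (hSchwarz Y)
  rwa [Matrix.mul_sub, Matrix.trace_sub, sub_nonneg, ← trace_map_mul hSchwarz] at h

lemma trace_mul_adjointMap_mul_conjTranspose_le {X : Matrix (Fin n) (Fin n) ℂ}
    (hX : X.PosSemidef) (Y : Matrix (Fin m) (Fin m) ℂ) :
    (X * (adjointMap Φ Y * (adjointMap Φ Y)ᴴ)).trace ≤ (Φ X * (Y * Yᴴ)).trace := by
  have h := trace_mul_conjTranspose_mul_adjointMap_le hSchwarz hX Yᴴ
  rwa [adjointMap_conjTranspose hSchwarz, conjTranspose_conjTranspose,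
    conjTranspose_conjTranspose] at h

end AdjointMap

section SpectralSums

variable {ι : Type*} [Fintype ι] [DecidableEq ι]

lemma trace_spectral_mul_spectral (U V X : Matrix ι ι ℂ) (p q : ι → ℝ) :
    ((U * (diagonal fun i => (p i : ℂ)) * Uᴴ) * X * (V * (diagonal fun j => (q j : ℂ)) * Vᴴ)
      * Xᴴ).trace
      = ((∑ i, ∑ j, p i * q j * Complex.normSq ((Uᴴ * X * V) i j) : ℝ) : ℂ) := by
  have h : ((U * (diagonal fun i => (p i : ℂ)) * Uᴴ) * X * (V * (diagonal fun j => (q j : ℂ)) * Vᴴ)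
      * Xᴴ).trace = ((diagonal fun i => (p i : ℂ)) * (Uᴴ * X * V)
        * (diagonal fun j => (q j : ℂ)) * (Uᴴ * X * V)ᴴ).trace := by
    simp only [conjTranspose_mul, conjTranspose_conjTranspose]
    rw [Matrix.mul_assoc U, Matrix.mul_assoc U, Matrix.mul_assoc U, Matrix.mul_assoc U,
      Matrix.trace_mul_comm U]
    simp only [Matrix.mul_assoc]
  rw [h]
  generalize Uᴴ * X * V = W
  simp only [Matrix.trace, Matrix.diag_apply, Matrix.mul_apply (N := Wᴴ), mul_diagonal,
    diagonal_mul, conjTranspose_apply, RCLike.star_def]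
  push_cast
  refine Finset.sum_congr rfl fun i _ => Finset.sum_congr rfl fun j _ => ?_
  rw [Complex.normSq_eq_conj_mul_self]
  ring

lemma Matrix.IsHermitian.cfc_eq_mul_diagonal_mul {A : Matrix ι ι ℂ} (hA : A.IsHermitian)
    (g : ℝ → ℝ) :
    cfc g A = (hA.eigenvectorUnitary : Matrix ι ι ℂ) *
      (diagonal fun i => (g (hA.eigenvalues i) : ℂ)) * (hA.eigenvectorUnitary : Matrix ι ι ℂ)ᴴ := by
  rw [hA.cfc_eq, Matrix.IsHermitian.cfc, Unitary.conjStarAlgAut_apply,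
    star_eq_conjTranspose]
  rfl

lemma Matrix.IsHermitian.eq_mul_diagonal_mul {A : Matrix ι ι ℂ} (hA : A.IsHermitian) :
    A = (hA.eigenvectorUnitary : Matrix ι ι ℂ) *
      (diagonal fun i => (hA.eigenvalues i : ℂ)) * (hA.eigenvectorUnitary : Matrix ι ι ℂ)ᴴ := by
  have h := hA.cfc_eq_mul_diagonal_mul id
  exact (cfc_id ℝ A hA.isSelfAdjoint).symm.trans h

lemma finsum_spectrum_specProj {n : ℕ} {A B : Matrix (Fin n) (Fin n) ℂ} (hA : A.IsHermitian)
    (hB : B.IsHermitian) (g : ℝ → ℝ → ℝ) :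
    (∑ᶠ a ∈ spectrum ℝ A, ∑ᶠ b ∈ spectrum ℝ B,
        g a b * (Matrix.trace (specProj A a * specProj B b)).re)
      = ∑ i, ∑ j, g (hA.eigenvalues i) (hB.eigenvalues j) * Complex.normSq
          (((hA.eigenvectorUnitary : Matrix (Fin n) (Fin n) ℂ)ᴴ *
            (hB.eigenvectorUnitary : Matrix (Fin n) (Fin n) ℂ)) i j) := by
  have htr : ∀ a b, (Matrix.trace (specProj A a * specProj B b)).re
      = ∑ i, ∑ j, (if hA.eigenvalues i = a then (1 : ℝ) else 0) *
          (if hB.eigenvalues j = b then (1 : ℝ) else 0) * Complex.normSq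
          (((hA.eigenvectorUnitary : Matrix (Fin n) (Fin n) ℂ)ᴴ *
            (hB.eigenvectorUnitary : Matrix (Fin n) (Fin n) ℂ)) i j) := by
    intro a b
    have h := trace_spectral_mul_spectral (hA.eigenvectorUnitary : Matrix (Fin n) (Fin n) ℂ)
      (hB.eigenvectorUnitary : Matrix (Fin n) (Fin n) ℂ) 1
      (fun i => if hA.eigenvalues i = a then 1 else 0)
      (fun j => if hB.eigenvalues j = b then 1 else 0)
    rw [conjTranspose_one, Matrix.mul_one, Matrix.mul_one, Matrix.mul_one] at h
    rw [specProj, specProj, hA.cfc_eq_mul_diagonal_mul, hB.cfc_eq_mul_diagonal_mul, h,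
      Complex.ofReal_re]
  have hmemA : ∀ i, hA.eigenvalues i ∈ A.finite_real_spectrum.toFinset := fun i => by
    simpa using hA.eigenvalues_mem_spectrum_real i
  have hmemB : ∀ j, hB.eigenvalues j ∈ B.finite_real_spectrum.toFinset := fun j => by
    simpa using hB.eigenvalues_mem_spectrum_real j
  rw [finsum_mem_eq_finite_toFinset_sum _ A.finite_real_spectrum]
  simp only [finsum_mem_eq_finite_toFinset_sum _ B.finite_real_spectrum, htr, Finset.mul_sum]
  simp only [Finset.sum_comm (s := B.finite_real_spectrum.toFinset)]
  simp only [Finset.sum_comm (s := A.finite_real_spectrum.toFinset)]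
  refine Finset.sum_congr rfl fun i _ => Finset.sum_congr rfl fun j _ => ?_
  rw [Finset.sum_eq_single_of_mem _ (hmemB j) fun b _ hb => ?_,
    Finset.sum_eq_single_of_mem _ (hmemA i) fun a _ ha => ?_]
  · simp
  · simp [ha.symm]
  · simp [hb.symm]

end SpectralSums

section Monotonicity

lemma trace_spectral_mul_mul_conjTranspose {ι : Type*} [Fintype ι] [DecidableEq ι]
    (U : Matrix ι ι ℂ) {V : Matrix ι ι ℂ} (hV : V * Vᴴ = 1) (X : Matrix ι ι ℂ) (p : ι → ℝ) :
    ((U * (diagonal fun i => (p i : ℂ)) * Uᴴ) * (X * Xᴴ)).trace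
      = ((∑ i, ∑ j, p i * Complex.normSq ((Uᴴ * X * V) i j) : ℝ) : ℂ) := by
  have h := trace_spectral_mul_spectral U V X p 1
  simpa [hV, ← Matrix.mul_assoc] using h

lemma trace_spectral_mul_conjTranspose_mul {ι : Type*} [Fintype ι] [DecidableEq ι]
    {U : Matrix ι ι ℂ} (hU : U * Uᴴ = 1) (V X : Matrix ι ι ℂ) (q : ι → ℝ) :
    ((V * (diagonal fun i => (q i : ℂ)) * Vᴴ) * (Xᴴ * X)).trace
      = ((∑ i, ∑ j, q j * Complex.normSq ((Uᴴ * X * V) i j) : ℝ) : ℂ) := by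
  have h := trace_spectral_mul_spectral U V X 1 q
  rw [← Matrix.mul_assoc, Matrix.trace_mul_comm, ← Matrix.mul_assoc]
  simpa [hU] using h

variable {n m : ℕ} {Φ : Matrix (Fin n) (Fin n) ℂ →ₗ[ℂ] Matrix (Fin m) (Fin m) ℂ}
  (hSchwarz : ∀ Y : Matrix (Fin m) (Fin m) ℂ,
      (adjointMap Φ (Yᴴ * Y) - (adjointMap Φ Y)ᴴ * adjointMap Φ Y).PosSemidef)

include hSchwarz

lemma adjointMap_kernel_eq_zero {X : Matrix (Fin n) (Fin n) ℂ} (hX : X.PosDef)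
    {U : Matrix (Fin m) (Fin m) ℂ} (hU : Uᴴ * U = 1) {α : Fin m → ℝ}
    (h : Φ X = U * (diagonal fun i => (α i : ℂ)) * Uᴴ) :
    adjointMap Φ (U * (diagonal fun i => ((if α i = 0 then 1 else 0 : ℝ) : ℂ)) * Uᴴ) = 0 := by
  refine adjointMap_eq_zero_of_map_mul_eq_zero hSchwarz hX ?_ ?_
  · refine Matrix.PosSemidef.mul_mul_conjTranspose_same (posSemidef_diagonal_iff.2 fun i => ?_) U
    rw [Complex.zero_le_real]
    split_ifs <;> norm_num
  · have h1 : Φ X * (U * (diagonal fun i => ((if α i = 0 then 1 else 0 : ℝ) : ℂ)) * Uᴴ)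
        = U * ((diagonal fun i => (α i : ℂ)) * (Uᴴ * U) *
          (diagonal fun i => ((if α i = 0 then 1 else 0 : ℝ) : ℂ))) * Uᴴ := by
      rw [h]; simp only [Matrix.mul_assoc]
    have h2 : (diagonal fun i => (α i : ℂ)) *
        (diagonal fun i => ((if α i = 0 then 1 else 0 : ℝ) : ℂ)) = 0 := by
      rw [diagonal_mul_diagonal, diagonal_eq_zero]
      funext i
      by_cases hi : α i = 0 <;> simp [hi]
    rw [h1, hU, Matrix.mul_one, h2, Matrix.mul_zero, Matrix.zero_mul]

lemma conjTranspose_mul_apply_eq_zero_of_kernel {X S : Matrix (Fin n) (Fin n) ℂ} (hX : X.PosDef)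
    {U V : Matrix (Fin m) (Fin m) ℂ} (hU : Uᴴ * U = 1) {α β : Fin m → ℝ} (hβ : ∀ l, 0 ≤ β l)
    (hΦX : Φ X = U * (diagonal fun i => (α i : ℂ)) * Uᴴ)
    (hΦS : Φ S = V * (diagonal fun i => (β i : ℂ)) * Vᴴ) {k l : Fin m} (hk : α k = 0)
    (hl : β l ≠ 0) : (Uᴴ * V) k l = 0 := by
  have h := trace_spectral_mul_spectral U V 1 (fun i => if α i = 0 then 1 else 0) β
  rw [conjTranspose_one, Matrix.mul_one, Matrix.mul_one, Matrix.mul_one, Matrix.trace_mul_comm,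
    ← hΦS, trace_map_mul hSchwarz, adjointMap_kernel_eq_zero hSchwarz hX hU hΦX, Matrix.mul_zero,
    Matrix.trace_zero, eq_comm, Complex.ofReal_eq_zero] at h
  have hnn : ∀ i j, 0 ≤ (if α i = 0 then (1 : ℝ) else 0) * β j * Complex.normSq ((Uᴴ * V) i j) := by
    intro i j
    have := hβ j
    have := Complex.normSq_nonneg ((Uᴴ * V) i j)
    split_ifs <;> positivity
  have h1 := (Finset.sum_eq_zero_iff_of_nonneg fun i _ => Finset.sum_nonneg fun j _ => hnn i j).1 h
    k (Finset.mem_univ k)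
  have h2 := (Finset.sum_eq_zero_iff_of_nonneg fun j _ => hnn k j).1 h1 l (Finset.mem_univ l)
  simpa [hk, hl] using h2

lemma OperatorConvexOn.sum_spectral_le_sum_spectral {f : ℝ → ℝ} (hf : OperatorConvexOn f)
    (hΦtr : ∀ X, (Φ X).trace = X.trace)
    {ρ σ : Matrix (Fin n) (Fin n) ℂ} (hρ : ρ.PosDef) (hσ : σ.PosDef)
    {U V : Matrix (Fin n) (Fin n) ℂ} (hU : U * Uᴴ = 1) (hV : V * Vᴴ = 1)
    {U' V' : Matrix (Fin m) (Fin m) ℂ} (hU' : U' * U'ᴴ = 1) (hV' : V' * V'ᴴ = 1)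
    {a b : Fin n → ℝ} {α β : Fin m → ℝ} (ha : ∀ i, 0 < a i) (hb : ∀ j, 0 < b j)
    (hα : ∀ k, 0 ≤ α k) (hβ : ∀ l, 0 ≤ β l)
    (hρU : ρ = U * (diagonal fun i => (a i : ℂ)) * Uᴴ)
    (hσV : σ = V * (diagonal fun i => (b i : ℂ)) * Vᴴ)
    (hΦρ : Φ ρ = U' * (diagonal fun i => (α i : ℂ)) * U'ᴴ)
    (hΦσ : Φ σ = V' * (diagonal fun i => (β i : ℂ)) * V'ᴴ) :
    ∑ k, ∑ l, (if α k = 0 ∨ β l = 0 then 0 else β l * f (α k / β l)) *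
        Complex.normSq ((U'ᴴ * V') k l)
      ≤ ∑ i, ∑ j, b j * f (a i / b j) * Complex.normSq ((Uᴴ * V) i j) := by
  have hU'' : U'ᴴ * U' = 1 := mul_eq_one_comm.1 hU'
  have hV'' : V'ᴴ * V' = 1 := mul_eq_one_comm.1 hV'
  set w' := U'ᴴ * V' with hw'
  have hαw : ∀ k l, α k = 0 → β l ≠ 0 → w' k l = 0 := fun k l hk hl =>
    conjTranspose_mul_apply_eq_zero_of_kernel hSchwarz hρ hU'' hβ hΦρ hΦσ hk hl
  have hβw : ∀ k l, β l = 0 → α k ≠ 0 → w' k l = 0 := fun k l hl hk => by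
    have h := conjTranspose_mul_apply_eq_zero_of_kernel hSchwarz hσ hV'' hα hΦσ hΦρ hl hk
    rw [hw', ← conjTranspose_conjTranspose V', ← conjTranspose_mul, conjTranspose_apply, h,
      star_zero]
  let Y : (Fin m × Fin m → ℂ) →ₗ[ℂ] Matrix (Fin m) (Fin m) ℂ :=
    { toFun := fun x => U' * (Matrix.of fun k l => x (k, l) * ((√(β l))⁻¹ : ℝ)) * V'ᴴ
      map_add' := fun x y => by
        rw [← Matrix.add_mul, ← Matrix.mul_add]
        congr 2
        ext k l
        simp [add_mul]
      map_smul' := fun c x => by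
        rw [RingHom.id_apply, ← Matrix.smul_mul, ← Matrix.mul_smul]
        congr 2
        ext k l
        simp [mul_assoc] }
  have hYapply : ∀ x k l, (U'ᴴ * Y x * V') k l = x (k, l) * ((√(β l))⁻¹ : ℝ) := by
    intro x k l
    have : U'ᴴ * Y x * V' = (U'ᴴ * U') * (Matrix.of fun k l => x (k, l) * ((√(β l))⁻¹ : ℝ))
        * (V'ᴴ * V') := by
      simp only [Y, LinearMap.coe_mk, AddHom.coe_mk, Matrix.mul_assoc]
    rw [this, hU'', hV'', Matrix.one_mul, Matrix.mul_one, Matrix.of_apply]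
  let L : (Fin m × Fin m → ℂ) →ₗ[ℂ] (Fin n × Fin n → ℂ) :=
    { toFun := fun x p => (Uᴴ * adjointMap Φ (Y x) * V) p.1 p.2 * (√(b p.2) : ℝ)
      map_add' := fun x y => by
        ext p
        simp [adjointMap_add, Matrix.mul_add, add_mul]
      map_smul' := fun c x => by
        ext p
        simp [adjointMap_smul, mul_assoc] }
  let d : Fin n × Fin n → ℝ := fun p => a p.1 / b p.2
  let e : Fin m × Fin m → ℝ := fun p => if α p.1 = 0 ∨ β p.2 = 0 then 1 else α p.1 / β p.2
  let ξ : Fin m × Fin m → ℂ := fun p => w' p.1 p.2 * (√(β p.2) : ℝ)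
  have hd : ∀ p, 0 < d p := fun p => div_pos (ha _) (hb _)
  have he : ∀ p, 0 < e p := fun p => by
    simp only [e]
    split_ifs with h
    · exact one_pos
    · push Not at h
      exact div_pos ((hα _).lt_of_ne' h.1) ((hβ _).lt_of_ne' h.2)
  have hL : ∀ x i j, Complex.normSq (L x (i, j))
      = b j * Complex.normSq ((Uᴴ * adjointMap Φ (Y x) * V) i j) := fun x i j => by
    simp only [L, LinearMap.coe_mk, AddHom.coe_mk, Complex.normSq_mul, Complex.normSq_ofReal,
      Real.mul_self_sqrt (hb j).le]
    ring
  have hξ : ∀ k l, Complex.normSq (ξ (k, l)) = β l * Complex.normSq (w' k l) := fun k l => by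
    simp only [ξ, Complex.normSq_mul, Complex.normSq_ofReal, Real.mul_self_sqrt (hβ l)]
    ring
  have hYsq : ∀ x k l, Complex.normSq ((U'ᴴ * Y x * V') k l)
      = Complex.normSq (x (k, l)) * (β l)⁻¹ := fun x k l => by
    rw [hYapply, Complex.normSq_mul, Complex.normSq_ofReal, ← mul_inv, Real.mul_self_sqrt (hβ l)]
  have hLξ : ∀ i j, Complex.normSq (L ξ (i, j)) = b j * Complex.normSq ((Uᴴ * V) i j) := by
    have hYξ : Y ξ = 1 + (-1 : ℂ) •
        (V' * (diagonal fun i => ((if β i = 0 then 1 else 0 : ℝ) : ℂ)) * V'ᴴ) := by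
      have h1 : (Matrix.of fun k l => ξ (k, l) * ((√(β l))⁻¹ : ℝ))
          = U'ᴴ * V' * (1 - diagonal fun i => ((if β i = 0 then 1 else 0 : ℝ) : ℂ)) := by
        ext k l
        rw [Matrix.mul_sub, Matrix.mul_one, Matrix.sub_apply, mul_diagonal, Matrix.of_apply]
        by_cases h : β l = 0
        · simp [h]
        · have : √(β l) ≠ 0 := (Real.sqrt_pos.2 ((hβ l).lt_of_ne' h)).ne'
          simp only [ξ, h, if_false, Complex.ofReal_zero, mul_zero, sub_zero]
          rw [mul_assoc, ← Complex.ofReal_mul, mul_inv_cancel₀ this, Complex.ofReal_one, mul_one]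
      simp only [Y, LinearMap.coe_mk, AddHom.coe_mk]
      rw [h1, ← Matrix.mul_assoc, ← Matrix.mul_assoc, hU', Matrix.one_mul, Matrix.mul_sub,
        Matrix.sub_mul, Matrix.mul_one, hV', neg_one_smul, sub_eq_add_neg]
    intro i j
    rw [hL, hYξ, adjointMap_add, adjointMap_smul, adjointMap_one hSchwarz hΦtr,
      adjointMap_kernel_eq_zero hSchwarz hσ hV'' hΦσ, smul_zero, add_zero, Matrix.mul_one]
  have hVcontr : ∀ x, ∑ p, Complex.normSq (L x p) ≤ ∑ p, Complex.normSq (x p) := by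
    intro x
    have h := trace_mul_conjTranspose_mul_adjointMap_le hSchwarz hσ.posSemidef (Y x)
    rw [hΦσ, trace_spectral_mul_conjTranspose_mul hU'] at h
    nth_rewrite 1 [hσV] at h
    rw [trace_spectral_mul_conjTranspose_mul hU, Complex.real_le_real] at h
    simp only [Fintype.sum_prod_type, hL]
    refine h.trans (Finset.sum_le_sum fun k _ => Finset.sum_le_sum fun l _ => ?_)
    rw [hYsq]
    rcases eq_or_ne (β l) 0 with h0 | h0
    · rw [h0, zero_mul]
      exact Complex.normSq_nonneg _
    · rw [mul_comm, mul_assoc, inv_mul_cancel₀ h0, mul_one]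
  have hRcontr : ∀ x, ∑ p, d p * Complex.normSq (L x p) ≤ ∑ p, e p * Complex.normSq (x p) := by
    intro x
    have h := trace_mul_adjointMap_mul_conjTranspose_le hSchwarz hρ.posSemidef (Y x)
    rw [hΦρ, trace_spectral_mul_mul_conjTranspose _ hV'] at h
    nth_rewrite 1 [hρU] at h
    rw [trace_spectral_mul_mul_conjTranspose _ hV, Complex.real_le_real] at h
    simp only [Fintype.sum_prod_type, hL]
    refine le_trans (le_of_eq ?_)
      (h.trans (Finset.sum_le_sum fun k _ => Finset.sum_le_sum fun l _ => ?_))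
    · refine Finset.sum_congr rfl fun i _ => Finset.sum_congr rfl fun j _ => ?_
      simp only [d]
      rw [← mul_assoc, div_mul_cancel₀ _ (hb j).ne']
    · rw [hYsq]
      have := Complex.normSq_nonneg (x (k, l))
      simp only [e]
      split_ifs with h0
      · rcases h0 with h0 | h0 <;> simp [h0, this]
      · exact le_of_eq (by ring)
  have hVξ : ∑ p, Complex.normSq (L ξ p) = ∑ p, Complex.normSq (ξ p) := by
    have h := hΦtr σ
    rw [hΦσ] at h
    nth_rewrite 1 [hσV] at h
    have h1 := trace_spectral_mul_conjTranspose_mul hU' V' 1 β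
    have h2 := trace_spectral_mul_conjTranspose_mul hU V 1 b
    rw [conjTranspose_one, Matrix.mul_one, Matrix.mul_one, Matrix.mul_one] at h1 h2
    rw [h1, h2, Complex.ofReal_inj] at h
    simp only [Fintype.sum_prod_type, hLξ, hξ]
    exact h.symm
  have hRξ : ∑ p, d p * Complex.normSq (L ξ p) = ∑ p, e p * Complex.normSq (ξ p) := by
    have h := hΦtr ρ
    rw [hΦρ] at h
    nth_rewrite 1 [hρU] at h
    have h1 := trace_spectral_mul_mul_conjTranspose U' hV' 1 α
    have h2 := trace_spectral_mul_mul_conjTranspose U hV 1 a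
    rw [conjTranspose_one, Matrix.mul_one, Matrix.mul_one, Matrix.mul_one] at h1 h2
    rw [h1, h2, Complex.ofReal_inj] at h
    simp only [Fintype.sum_prod_type, hLξ, hξ]
    refine Eq.trans ?_ (h.symm.trans ?_)
    · refine Finset.sum_congr rfl fun i _ => Finset.sum_congr rfl fun j _ => ?_
      simp only [d]
      rw [← mul_assoc, div_mul_cancel₀ _ (hb j).ne']
    · refine Finset.sum_congr rfl fun k _ => Finset.sum_congr rfl fun l _ => ?_
      simp only [e]
      rcases eq_or_ne (α k) 0 with hk | hk <;> rcases eq_or_ne (β l) 0 with hl | hl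
      · simp [hk, hl]
      · simp [hk, ← hw', hαw k l hk hl]
      · simp [hl, ← hw', hβw k l hl hk]
      · rw [if_neg (by simp [hk, hl]), ← mul_assoc, div_mul_cancel₀ _ hl]
  have key := hf.sum_le_sum_of_contraction hd he L hVcontr hVξ hRcontr hRξ
  simp only [Fintype.sum_prod_type, hLξ, hξ] at key
  refine le_trans (le_of_eq ?_) (key.trans (le_of_eq ?_))
  · refine Finset.sum_congr rfl fun k _ => Finset.sum_congr rfl fun l _ => ?_
    simp only [e]
    rcases eq_or_ne (β l) 0 with hl | hl
    · simp [hl]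
    · rcases eq_or_ne (α k) 0 with hk | hk
      · simp [hαw k l hk hl]
      · rw [if_neg (by simp [hk, hl]), if_neg (by simp [hk, hl])]
        ring
  · refine Finset.sum_congr rfl fun i _ => Finset.sum_congr rfl fun j _ => ?_
    simp only [d]
    ring

end Monotonicity

/-- monotonicity of the standard `f`-divergence under a trace-preserving map
whose Hilbert–Schmidt adjoint is a Schwarz contraction, for operator convex `f` and positive
definite `ρ, σ`; on the output side the sum runs over the nonzero eigenvalues only. -/
theorem stmt14 {n m : ℕ}
    (Φ : Matrix (Fin n) (Fin n) ℂ →ₗ[ℂ] Matrix (Fin m) (Fin m) ℂ)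
    (hΦtr : ∀ X, (Φ X).trace = X.trace)
    (hSchwarz : ∀ Y : Matrix (Fin m) (Fin m) ℂ,
      (adjointMap Φ (Yᴴ * Y) - (adjointMap Φ Y)ᴴ * adjointMap Φ Y).PosSemidef)
    (f : ℝ → ℝ) (hf : OperatorConvexOn f)
    (ρ σ : Matrix (Fin n) (Fin n) ℂ) (hρ : ρ.PosDef) (hσ : σ.PosDef) :
    (∑ᶠ a ∈ spectrum ℝ (Φ ρ), ∑ᶠ b ∈ spectrum ℝ (Φ σ),
        if a = 0 ∨ b = 0 then 0 else
          b * f (a / b) * (Matrix.trace (specProj (Φ ρ) a * specProj (Φ σ) b)).re)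
      ≤ ∑ᶠ a ∈ spectrum ℝ ρ, ∑ᶠ b ∈ spectrum ℝ σ,
          b * f (a / b) * (Matrix.trace (specProj ρ a * specProj σ b)).re := by
  have hΦρ := map_posSemidef hSchwarz hρ.posSemidef
  have hΦσ := map_posSemidef hSchwarz hσ.posSemidef
  have hite : ∀ a b t : ℝ, (if a = 0 ∨ b = 0 then 0 else b * f (a / b) * t)
      = (if a = 0 ∨ b = 0 then 0 else b * f (a / b)) * t := fun a b t => by
    rw [ite_mul, zero_mul]
  simp only [hite]
  rw [finsum_spectrum_specProj hΦρ.isHermitian hΦσ.isHermitian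
      fun a b => if a = 0 ∨ b = 0 then 0 else b * f (a / b),
    finsum_spectrum_specProj hρ.isHermitian hσ.isHermitian fun a b => b * f (a / b)]
  exact hf.sum_spectral_le_sum_spectral hSchwarz hΦtr hρ hσ
    (Unitary.coe_mul_star_self _) (Unitary.coe_mul_star_self _)
    (Unitary.coe_mul_star_self _) (Unitary.coe_mul_star_self _)
    hρ.eigenvalues_pos hσ.eigenvalues_pos hΦρ.eigenvalues_nonneg hΦσ.eigenvalues_nonneg
    hρ.isHermitian.eq_mul_diagonal_mul hσ.isHermitian.eq_mul_diagonal_mul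
    hΦρ.isHermitian.eq_mul_diagonal_mul hΦσ.isHermitian.eq_mul_diagonal_mul
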